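/- Let n ≥ 2 and d ≥ 2. There is no continuous map F : (Fin n → EuclideanSpace ℝ (Fin d)) → (Fin n → EuclideanSpace ℝ (Fin d)) that is permutation-invariant, i.e. F (v ∘ σ) = F v for every tuple v and every permutation σ : Equiv.Perm (Fin n), and that satisfies: for every injective tuple v there exists a permutation σ : Equiv.Perm (Fin n) with F v = v ∘ σ. -/

import Mathlib

/-- A map to a finite type whose fibers are all closed is locally constant. -/
theorem isLocallyConstant_of_isClosed_fiber {X ι : Type*} [TopologicalSpace X] [Finite ι]
    (f : X → ι) (hf : ∀ i, IsClosed {x | f x = i}) : IsLocallyConstant f := by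
  intro s
  have h : IsClosed (⋃ i ∈ sᶜ, {x | f x = i}) :=
    (Set.toFinite sᶜ).isClosed_biUnion fun i _ => hf i
  rw [← isClosed_compl_iff]
  convert h using 1
  ext x
  simp

/-- Along a continuous path of injective tuples, a continuous map listing the entries does so
by one and the same permutation. -/
theorem exists_perm_forall_eq_comp {X E : Type*} [TopologicalSpace X] [PreconnectedSpace X]
    [Nonempty X] [TopologicalSpace E] [T2Space E] {n : ℕ} {F : (Fin n → E) → (Fin n → E)}
    (hF : Continuous F)
    (hlist : ∀ v : Fin n → E, Function.Injective v → ∃ σ : Equiv.Perm (Fin n), F v = v ∘ σ)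
    {p : X → Fin n → E} (hp : Continuous p) (hinj : ∀ t, Function.Injective (p t)) :
    ∃ σ : Equiv.Perm (Fin n), ∀ t, F (p t) = p t ∘ σ := by
  choose σ hσ using fun t => hlist (p t) (hinj t)
  have hconst : IsLocallyConstant σ := by
    refine isLocallyConstant_of_isClosed_fiber σ fun s => ?_
    have hset : {t | σ t = s} = {t | F (p t) = p t ∘ s} := by
      ext t
      refine ⟨fun h => ?_, fun h => ?_⟩
      · have h' : σ t = s := h
        exact h' ▸ hσ t
      · have h' : F (p t) = p t ∘ s := h
        rw [hσ t] at h'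
        exact Equiv.ext fun i => hinj t (congrFun h' i)
    rw [hset]
    exact isClosed_eq (hF.comp hp)
      (continuous_pi fun i => (continuous_apply (s i)).comp hp)
  obtain ⟨t₀⟩ := ‹Nonempty X›
  refine ⟨σ t₀, fun t => ?_⟩
  rw [hσ t, hconst.apply_eq_of_preconnectedSpace t t₀]

/-- A path of tuples: the entries `a` and `b` rotate as antipodal points of the unit circle
in the plane of the coordinates `x` and `y`, while the other entries rest at distinct points outside
that circle. -/
noncomputable def rotatingTuple {n d : ℕ} (a b : Fin n) (x y : Fin d) (t : ℝ) :
    Fin n → EuclideanSpace ℝ (Fin d) := fun j =>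
  if j = a then
    Real.cos t • EuclideanSpace.single x 1 + Real.sin t • EuclideanSpace.single y 1
  else if j = b then
    -(Real.cos t • EuclideanSpace.single x 1 + Real.sin t • EuclideanSpace.single y 1)
  else ((j : ℝ) + 2) • EuclideanSpace.single x 1

theorem continuous_rotatingTuple {n d : ℕ} (a b : Fin n) (x y : Fin d) :
    Continuous (rotatingTuple a b x y) := by
  refine continuous_pi fun j => ?_
  unfold rotatingTuple
  split_ifs <;> fun_prop

theorem rotatingTuple_injective {n d : ℕ} (a b : Fin n) {x y : Fin d} (hxy : x ≠ y) (t : ℝ) :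
    Function.Injective (rotatingTuple a b x y t) := by
  intro i j h
  have hx := congrArg (fun w : EuclideanSpace ℝ (Fin d) => w x) h
  have hy := congrArg (fun w : EuclideanSpace ℝ (Fin d) => w y) h
  have hcs := Real.sin_sq_add_cos_sq t
  have hi : (0 : ℝ) ≤ (i : ℕ) := Nat.cast_nonneg _
  have hj : (0 : ℝ) ≤ (j : ℕ) := Nat.cast_nonneg _
  unfold rotatingTuple at hx hy
  split_ifs at hx hy <;> simp [hxy, hxy.symm] at hx hy <;>
    first
    | (subst_vars; rfl)
    | exact Fin.ext hx
    | (exfalso; nlinarith)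

theorem rotatingTuple_pi {n d : ℕ} {a b : Fin n} (hab : a ≠ b) (x y : Fin d) :
    rotatingTuple a b x y Real.pi = rotatingTuple a b x y 0 ∘ Equiv.swap a b := by
  funext j
  rcases eq_or_ne j a with rfl | ha
  · simp [rotatingTuple, hab.symm]
  rcases eq_or_ne j b with rfl | hb
  · simp [rotatingTuple, ha]
  · simp [rotatingTuple, ha, hb, Equiv.swap_apply_of_ne_of_ne]

/-- No continuous, permutation-invariant map can output a listing of its input's
entries (in some order) on all injective tuples. -/
theorem no_continuous_invariant_listing (n d : ℕ) (hn : 2 ≤ n) (hd : 2 ≤ d) :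
    ¬ ∃ F : (Fin n → EuclideanSpace ℝ (Fin d)) → (Fin n → EuclideanSpace ℝ (Fin d)),
        Continuous F ∧
        (∀ (v : Fin n → EuclideanSpace ℝ (Fin d)) (σ : Equiv.Perm (Fin n)),
          F (v ∘ σ) = F v) ∧
        (∀ v : Fin n → EuclideanSpace ℝ (Fin d), Function.Injective v →
          ∃ σ : Equiv.Perm (Fin n), F v = v ∘ σ) := by
  rintro ⟨F, hF, hinv, hlist⟩
  let a : Fin n := ⟨0, by omega⟩
  let b : Fin n := ⟨1, by omega⟩
  let x : Fin d := ⟨0, by omega⟩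
  let y : Fin d := ⟨1, by omega⟩
  have hab : a ≠ b := by simp [a, b]
  have hxy : x ≠ y := by simp [x, y]
  have hinj := rotatingTuple_injective a b hxy
  obtain ⟨σ, hσ⟩ :=
    exists_perm_forall_eq_comp hF hlist (continuous_rotatingTuple a b x y) hinj
  have h : rotatingTuple a b x y 0 ∘ Equiv.swap a b ∘ σ = rotatingTuple a b x y 0 ∘ σ := by
    rw [← hσ 0, ← hinv _ (Equiv.swap a b), ← rotatingTuple_pi hab, hσ, rotatingTuple_pi hab]
    rfl
  have h' := hinj 0 (congrFun h (σ.symm a))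
  simp only [Function.comp_apply, Equiv.apply_symm_apply, Equiv.swap_apply_left] at h'
  exact hab h'.symm
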